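/- Let Q be a finite set and let E = Q^n be equipped with the Hamming distance. A code C ⊆ E is (s,t)-separating if and only if for any disjoint subsets S, T ⊆ C with |S| ≤ s and |T| ≤ t, there exists a coordinate i (1 ≤ i ≤ n) such that π_i(S) ∩ π_i(T) = ∅. -/

import Mathlib

variable {Q : Type*} [Fintype Q] [DecidableEq Q] {n : ℕ}

/-- The metric segment `[x,y]` in the Hamming space `Q^n`. -/
def hammingSeg (x y : Fin n → Q) : Set (Fin n → Q) :=
  {z | hammingDist x y = hammingDist x z + hammingDist z y}

/-- A subset `K ⊆ Q^n` is convex (for the Hamming metric) if it contains the segment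
between any two of its points. -/
def HammingConvex (K : Set (Fin n → Q)) : Prop :=
  ∀ x ∈ K, ∀ y ∈ K, hammingSeg x y ⊆ K

/-- The convex hull of `S ⊆ Q^n`: the smallest Hamming-convex set containing `S`. -/
def hammingHull (S : Set (Fin n → Q)) : Set (Fin n → Q) :=
  ⋂₀ {K : Set (Fin n → Q) | HammingConvex K ∧ S ⊆ K}

/-- A code `C ⊆ Q^n` is `(s,t)`-separating if for any subsets `S, T ⊆ C` with
`|S| ≤ s`, `|T| ≤ t` and `S ∩ T = ∅`, one has `hull(S) ∩ hull(T) = ∅`. -/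
def HammingSeparating (s t : ℕ) (C : Set (Fin n → Q)) : Prop :=
  ∀ S T : Finset (Fin n → Q), ↑S ⊆ C → ↑T ⊆ C → S.card ≤ s → T.card ≤ t →
    Disjoint S T → hammingHull (↑S : Set (Fin n → Q)) ∩ hammingHull ↑T = ∅

section HullDescription

variable {α : Type*} [DecidableEq α]

theorem hammingDist_eq_sum (x y : Fin n → α) :
    hammingDist x y = ∑ i, if x i = y i then 0 else 1 := by
  simp [hammingDist, Finset.card_filter, ite_not]

theorem mem_hammingSeg_iff (x y z : Fin n → α) :
    z ∈ hammingSeg x y ↔ ∀ i, z i = x i ∨ z i = y i := by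
  have hle : ∀ i ∈ Finset.univ, (if x i = y i then 0 else 1) ≤
      (if x i = z i then 0 else 1) + (if z i = y i then 0 else 1) := by
    intro i _
    grind
  simp only [hammingSeg, Set.mem_ofPred_eq, hammingDist_eq_sum]
  rw [← Finset.sum_add_distrib, Finset.sum_eq_sum_iff_of_le hle]
  refine ⟨fun h i => ?_, fun h i _ => ?_⟩
  · have := h i (Finset.mem_univ i)
    grind
  · have := h i
    grind

theorem hammingConvex_setOf_forall_mem (A : Fin n → Set α) :
    HammingConvex {z : Fin n → α | ∀ i, z i ∈ A i} := by
  intro x hx y hy z hz i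
  rcases (mem_hammingSeg_iff x y z).1 hz i with h | h
  · exact h ▸ hx i
  · exact h ▸ hy i

theorem HammingConvex.mem_of_forall_mem_image {K : Set (Fin n → α)} (hK : HammingConvex K)
    (hne : K.Nonempty) {z : Fin n → α} (hz : ∀ i, z i ∈ (fun x : Fin n → α => x i) '' K) :
    z ∈ K := by
  have agree : ∀ A : Finset (Fin n), ∃ y ∈ K, ∀ i ∈ A, y i = z i := by
    intro A
    induction A using Finset.induction_on with
    | empty => exact hne.imp fun y hy => ⟨hy, by simp⟩
    | insert i A _ ih =>
      obtain ⟨y, hy, hyA⟩ := ih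
      obtain ⟨x, hx, hxi⟩ := hz i
      refine ⟨Function.update y i (x i),
        hK y hy x hx ((mem_hammingSeg_iff _ _ _).2 fun j => ?_), fun j hj => ?_⟩
      · by_cases hji : j = i
        · subst hji
          simp
        · simp [hji]
      · by_cases hji : j = i
        · subst hji
          simpa using hxi
        · simpa [hji] using hyA j (Finset.mem_of_mem_insert_of_ne hj hji)
  obtain ⟨y, hy, hyz⟩ := agree Finset.univ
  rwa [← funext fun i => hyz i (Finset.mem_univ i)]

theorem mem_hammingHull_iff {S : Set (Fin n → α)} (hS : S.Nonempty) (z : Fin n → α) :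
    z ∈ hammingHull S ↔ ∀ i, z i ∈ (fun x : Fin n → α => x i) '' S := by
  refine ⟨fun h => ?_, fun h K hK => ?_⟩
  · exact h _ ⟨hammingConvex_setOf_forall_mem fun i => (fun x : Fin n → α => x i) '' S,
      fun x hx i => ⟨x, hx, rfl⟩⟩
  · exact hK.1.mem_of_forall_mem_image (hS.mono hK.2) fun i => Set.image_mono hK.2 (h i)

theorem hammingHull_empty : hammingHull (∅ : Set (Fin n → α)) = ∅ :=
  Set.subset_empty_iff.1 fun _ h => h ∅ ⟨fun _ hx => hx.elim, subset_rfl⟩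

theorem hammingHull_inter_eq_empty_iff (hn : 0 < n) (S T : Set (Fin n → α)) :
    hammingHull S ∩ hammingHull T = ∅ ↔
      ∃ i : Fin n,
        ((fun z : Fin n → α => z i) '' S) ∩ ((fun z : Fin n → α => z i) '' T) = ∅ := by
  rcases S.eq_empty_or_nonempty with rfl | hS
  · simpa [hammingHull_empty] using Fin.pos_iff_nonempty.1 hn
  rcases T.eq_empty_or_nonempty with rfl | hT
  · simpa [hammingHull_empty] using Fin.pos_iff_nonempty.1 hn
  constructor
  · intro h
    by_contra! hsep
    choose z hz using hsep
    exact (h.subset ⟨(mem_hammingHull_iff hS z).2 fun i => (hz i).1,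
      (mem_hammingHull_iff hT z).2 fun i => (hz i).2⟩).elim
  · rintro ⟨i, hi⟩
    refine Set.subset_empty_iff.1 fun z hz => ?_
    exact (hi.subset ⟨(mem_hammingHull_iff hS z).1 hz.1 i,
      (mem_hammingHull_iff hT z).1 hz.2 i⟩).elim

end HullDescription

/-- A code `C ⊆ Q^n` is `(s,t)`-separating iff any disjoint `S, T ⊆ C` with
`|S| ≤ s`, `|T| ≤ t` admit a separating coordinate `i`, i.e. one with
`π_i(S) ∩ π_i(T) = ∅`. -/
theorem hammingSeparating_iff (hn : 0 < n) (s t : ℕ) (C : Set (Fin n → Q)) :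
    HammingSeparating s t C ↔
      ∀ S T : Finset (Fin n → Q), ↑S ⊆ C → ↑T ⊆ C → S.card ≤ s → T.card ≤ t →
        Disjoint S T →
        ∃ i : Fin n,
          ((fun z : Fin n → Q => z i) '' ↑S) ∩ ((fun z : Fin n → Q => z i) '' ↑T) = ∅ := by
  simp only [HammingSeparating, hammingHull_inter_eq_empty_iff hn]
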